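/- Let n ≥ 19 be an integer. Then there exist n×n complex matrices X, N that are skew-Hermitian (Xᴴ = -X, Nᴴ = -N) with trace X = trace N = 0, satisfying trace (X^2) = -1, trace (N^2) = -1, trace (X*N) = 0, and such that 1/n^2 + (Re trace ((X*N)^2 + N^4)) / (2*n) < 0. -/

import Mathlib

open Matrix

/-- The product of a matrix supported on the entries `(i, j)` and `(j, i)` with a diagonal
matrix. -/
lemma single_add_single_mul_diagonal {ι R : Type*} [Fintype ι] [DecidableEq ι] [CommSemiring R]
    (i j : ι) (a b : R) (d : ι → R) :
    (single i j a + single j i b) * diagonal d = single i j (a * d j) + single j i (b * d i) := by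
  ext k l
  simp only [mul_diagonal, Matrix.add_apply, single_apply, add_mul, ite_mul, zero_mul]
  congr 1 <;> split_ifs with h <;> first | rw [h.2] | rfl

lemma trace_single_add_single_sq {ι R : Type*} [Fintype ι] [DecidableEq ι] [CommSemiring R]
    {i j : ι} (hij : i ≠ j) (a b : R) :
    trace ((single i j a + single j i b) ^ 2) = 2 * (a * b) := by
  simp [sq, mul_add, add_mul, hij, hij.symm]
  ring

lemma trace_single_add_single {ι R : Type*} [Fintype ι] [DecidableEq ι] [CommSemiring R]
    {i j : ι} (hij : i ≠ j) (a b : R) :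
    trace (single i j a + single j i b) = 0 := by
  simp [trace_single_eq_of_ne, hij, hij.symm]

lemma trace_diagonal_pow {ι R : Type*} [Fintype ι] [DecidableEq ι] [CommSemiring R]
    (d : ι → R) (k : ℕ) : trace (diagonal d ^ k) = ∑ i, d i ^ k := by
  simp [diagonal_pow]

/-- Eigenvalues `1/2`, `-1/2`, eight times `√2/8` and eight times `-√2/8`, padded by zeros. -/
lemma exists_eigenvalues (n : ℕ) (hn : 18 ≤ n) :
    ∃ (b : Fin n → ℝ) (i j : Fin n), i ≠ j ∧ b i = 1 / 2 ∧ b j = -1 / 2 ∧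
      ∑ k, b k = 0 ∧ ∑ k, b k ^ 2 = 1 ∧ ∑ k, b k ^ 4 = 9 / 64 := by
  obtain ⟨m, rfl⟩ := Nat.exists_eq_add_of_le hn
  obtain ⟨c, hc⟩ : ∃ c : ℝ, c ^ 2 = 1 / 32 := ⟨√(1 / 32), Real.sq_sqrt (by norm_num)⟩
  have hc4 : c ^ 4 = 1 / 1024 := by rw [show c ^ 4 = (c ^ 2) ^ 2 by ring, hc]; norm_num
  refine ⟨Fin.append ![1 / 2, -1 / 2, c, c, c, c, c, c, c, c, -c, -c, -c, -c, -c, -c, -c, -c] 0,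
    Fin.castAdd m 0, Fin.castAdd m 1, ?_, ?_, ?_, ?_, ?_, ?_⟩
  · simp [Fin.ext_iff]
  · rw [Fin.append_left]; rfl
  · rw [Fin.append_left]; rfl
  all_goals
    simp only [Fin.sum_univ_add, Fin.append_left, Fin.append_right, Pi.zero_apply]
    simp [Fin.sum_univ_succ]
  · ring
  · linear_combination 16 * hc
  · rw [Even.neg_pow (by decide), hc4]
    norm_num

theorem stmt_7 (n : ℕ) (hn : 19 ≤ n) :
    ∃ X N : Matrix (Fin n) (Fin n) ℂ,
      Xᴴ = -X ∧ Nᴴ = -N ∧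
      Matrix.trace X = 0 ∧ Matrix.trace N = 0 ∧
      Matrix.trace (X ^ 2) = -1 ∧ Matrix.trace (N ^ 2) = -1 ∧
      Matrix.trace (X * N) = 0 ∧
      1 / (n : ℝ) ^ 2 + (Matrix.trace ((X * N) ^ 2 + N ^ 4)).re / (2 * n) < 0 := by
  obtain ⟨b, i, j, hij, hi, hj, h1, h2, h4⟩ := exists_eigenvalues n (by omega)
  obtain ⟨s, hs⟩ : ∃ s : ℝ, s ^ 2 = 1 / 2 := ⟨√(1 / 2), Real.sq_sqrt (by norm_num)⟩
  have hs' : (s : ℂ) ^ 2 = 1 / 2 := by simpa using congrArg Complex.ofReal hs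
  have h1' : ∑ k, (b k : ℂ) = 0 := by exact_mod_cast congrArg Complex.ofReal h1
  have h2' : ∑ k, (b k : ℂ) ^ 2 = 1 := by exact_mod_cast congrArg Complex.ofReal h2
  have h4' : ∑ k, (b k : ℂ) ^ 4 = 9 / 64 := by simpa using congrArg Complex.ofReal h4
  refine ⟨single i j (Complex.I * s) + single j i (Complex.I * s),
    diagonal fun k => Complex.I * b k, ?_, ?_, trace_single_add_single hij _ _, ?_, ?_, ?_, ?_, ?_⟩
  · rw [conjTranspose_add, conjTranspose_single, conjTranspose_single, neg_add, add_comm]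
    simp [← single_neg]
  · rw [diagonal_conjTranspose, diagonal_neg]
    congr 1
    ext k
    simp
  · rw [trace_diagonal, ← Finset.mul_sum, h1', mul_zero]
  · rw [trace_single_add_single_sq hij]
    linear_combination 2 * (s : ℂ) ^ 2 * Complex.I_sq - 2 * hs'
  · simp only [trace_diagonal_pow, mul_pow, ← Finset.mul_sum, h2', Complex.I_sq, mul_one]
  · rw [single_add_single_mul_diagonal, trace_single_add_single hij]
  · have key : trace (((single i j (Complex.I * s) + single j i (Complex.I * s)) *
        diagonal fun k => Complex.I * (b k : ℂ)) ^ 2 + (diagonal fun k => Complex.I * (b k : ℂ)) ^ 4)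
        = ((-7 / 64 : ℝ) : ℂ) := by
      rw [trace_add, single_add_single_mul_diagonal, trace_single_add_single_sq hij,
        trace_diagonal_pow, hi, hj]
      simp only [mul_pow, ← Finset.mul_sum, h4', Complex.I_pow_four]
      push_cast
      linear_combination (-1 / 2 * (s : ℂ) ^ 2) * Complex.I_pow_four - 1 / 2 * hs'
    rw [key, Complex.ofReal_re]
    have hn' : (19 : ℝ) ≤ n := by exact_mod_cast hn
    have hpos : (0 : ℝ) < n := by linarith
    have : 1 / (n : ℝ) ^ 2 + -7 / 64 / (2 * n) = (128 - 7 * n) / (128 * n ^ 2) := by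
      field_simp
      ring
    rw [this]
    exact div_neg_of_neg_of_pos (by linarith) (by positivity)
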